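/- arXiv:2405.12474 — 3 statements merged into one kernel-verified Lean document; each statement's English description precedes it below -/
import Mathlib

section
/- Let G = (V, E) be a finite simple graph with m > 0 edges, let ℓ : V → C be a labeling, and let h = |{{u,v} ∈ E : ℓ_u = ℓ_v}| / m be the homophily ratio. Let z : V → ℝ with D := Σ_{u∈V} d_u z_u² > 0. Suppose there exist real numbers δ > 0, c ≥ 0 and Γ ≥ 1 such that |z_u − z_v| ≤ c·δ for every edge {u,v} with ℓ_u = ℓ_v, and δ ≤ |z_u − z_v| ≤ Γ·δ for every edge {u,v} with ℓ_u ≠ ℓ_v. Then the spectral signal frequency of z satisfies ((1−h)·m·δ²)/(2D) ≤ f(z) ≤ ((c²·h + Γ²·(1−h))·m·δ²)/(2D). -/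
open Finset

/-- For a finite simple graph with `m > 0` edges, a labeling `ℓ`,
homophily ratio `h` (fraction of edges whose endpoints share a label), and a signal `z`
with `D = Σ_u d_u z_u² > 0`, if `|z_u − z_v| ≤ c δ` on homophilous edges and
`δ ≤ |z_u − z_v| ≤ Γ δ` on heterophilous edges, then
`((1−h) m δ²)/(2D) ≤ f(z) ≤ ((c² h + Γ² (1−h)) m δ²)/(2D)`, where
`f(z) = (Σ_{{u,v}∈E} (z_u − z_v)²)/(2D)`. -/
theorem stmt1 {V C : Type*} [Fintype V] [DecidableEq V] [DecidableEq C]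
    (G : SimpleGraph V) [DecidableRel G.Adj] (ℓ : V → C)
    (m : ℝ) (hm : m = (G.edgeFinset.card : ℝ)) (hmpos : 0 < m)
    (h : ℝ)
    (hh : h = (∑ e ∈ G.edgeFinset,
        Sym2.lift ⟨fun u v => if ℓ u = ℓ v then (1 : ℝ) else 0,
          fun _ _ => by simp only [eq_comm]⟩ e) / m)
    (z : V → ℝ) (D : ℝ) (hD : D = ∑ u, (G.degree u : ℝ) * z u ^ 2) (hDpos : 0 < D)
    (δ c Γ : ℝ) (hδ : 0 < δ) (hc : 0 ≤ c) (hΓ : 1 ≤ Γ)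
    (hhomo : ∀ u v, G.Adj u v → ℓ u = ℓ v → |z u - z v| ≤ c * δ)
    (hhet : ∀ u v, G.Adj u v → ℓ u ≠ ℓ v → δ ≤ |z u - z v| ∧ |z u - z v| ≤ Γ * δ) :
    ((1 - h) * m * δ ^ 2) / (2 * D) ≤
      (∑ e ∈ G.edgeFinset, Sym2.lift ⟨fun u v => (z u - z v) ^ 2, fun _ _ => by ring⟩ e) /
        (2 * D) ∧
    (∑ e ∈ G.edgeFinset, Sym2.lift ⟨fun u v => (z u - z v) ^ 2, fun _ _ => by ring⟩ e) /
        (2 * D) ≤ ((c ^ 2 * h + Γ ^ 2 * (1 - h)) * m * δ ^ 2) / (2 * D) := by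
  set s : Sym2 V → ℝ := Sym2.lift ⟨fun u v => if ℓ u = ℓ v then (1 : ℝ) else 0,
    fun _ _ => by simp only [eq_comm]⟩ with hs
  set q : Sym2 V → ℝ := Sym2.lift ⟨fun u v => (z u - z v) ^ 2, fun _ _ => by ring⟩ with hq
  have hsum : ∑ e ∈ G.edgeFinset, s e = h * m := by
    rw [hh, div_mul_cancel₀ _ hmpos.ne']
  have hedge : ∀ e ∈ G.edgeFinset, (1 - s e) * δ ^ 2 ≤ q e ∧
      q e ≤ (c ^ 2 * s e + Γ ^ 2 * (1 - s e)) * δ ^ 2 := by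
    intro e he
    induction e using Sym2.ind with
    | _ u v =>
      have hadj : G.Adj u v := by simpa using he
      simp only [hs, hq, Sym2.lift_mk]
      rw [← sq_abs (z u - z v)]
      by_cases huv : ℓ u = ℓ v
      · have hle := pow_le_pow_left₀ (abs_nonneg _) (hhomo u v hadj huv) 2
        rw [if_pos huv]
        exact ⟨by linarith [sq_nonneg |z u - z v|], by linarith [mul_pow c δ 2]⟩
      · obtain ⟨hlow, hupp⟩ := hhet u v hadj huv
        have hle := pow_le_pow_left₀ hδ.le hlow 2
        have hge := pow_le_pow_left₀ (abs_nonneg _) hupp 2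
        rw [if_neg huv]
        exact ⟨by linarith, by linarith [mul_pow Γ δ 2]⟩
  have hcompl : ∑ e ∈ G.edgeFinset, (1 - s e) = (1 - h) * m := by
    rw [sum_sub_distrib, hsum, sum_const, nsmul_eq_mul, mul_one, ← hm]
    ring
  have hlower := sum_le_sum fun e he => (hedge e he).1
  have hupper := sum_le_sum fun e he => (hedge e he).2
  rw [← sum_mul, hcompl] at hlower
  rw [← sum_mul, sum_add_distrib, ← mul_sum, ← mul_sum, hsum, hcompl] at hupper
  constructor
  · gcongr
  · gcongr
    linarith
end

section
/- Let P be a real symmetric n×n matrix with all eigenvalues in (−1, 1] (i.e., I + P is positive definite and I − P is positive semidefinite), and let x ∈ ℝⁿ be a vector whose orthogonal projection onto the eigenspace ker(P − I) is nonzero. Then Pᵏx ≠ 0 for every k ∈ ℕ, and the cosine of the angle between consecutive basis vectors, cos_k := ⟨Pᵏx, P^{k+1}x⟩ / (‖Pᵏx‖·‖P^{k+1}x‖), converges to 1 as k → ∞; equivalently, the angle arccos(cos_k) converges to 0. -/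
open Matrix Filter

lemma Matrix.pow_mulVec_of_mulVec_eq_smul {ι R : Type*} [Fintype ι] [DecidableEq ι]
    [CommSemiring R] {A : Matrix ι ι R} {v : ι → R} {r : R} (h : A *ᵥ v = r • v) (k : ℕ) :
    (A ^ k) *ᵥ v = r ^ k • v := by
  induction k with
  | zero => simp
  | succ k ih => rw [pow_succ, ← mulVec_mulVec, h, mulVec_smul, ih, smul_smul, pow_succ']

lemma exists_tendsto_pow_of_mem_Ioc {r : ℝ} (hr : r ∈ Set.Ioc (-1) 1) :
    ∃ l : ℝ, Tendsto (fun k : ℕ => r ^ k) atTop (nhds l) := by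
  rcases hr.2.eq_or_lt with rfl | h
  · exact ⟨1, by simp⟩
  · exact ⟨0, tendsto_pow_atTop_nhds_zero_of_abs_lt_one (abs_lt.2 ⟨hr.1, h⟩)⟩

lemma Matrix.IsHermitian.eigenvalues_mem_Ioc {ι : Type*} [Fintype ι] [DecidableEq ι]
    {P : Matrix ι ι ℝ} (hP : P.IsHermitian) (hpd : (1 + P).PosDef)
    (hpsd : (1 - P).PosSemidef) (i : ι) : hP.eigenvalues i ∈ Set.Ioc (-1) 1 := by
  have hv := hP.mulVec_eigenvectorBasis i
  set v : ι → ℝ := ⇑(hP.eigenvectorBasis i)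
  have hv0 : v ≠ 0 := fun h =>
    hP.eigenvectorBasis.orthonormal.ne_zero i (by ext j; exact congrFun h j)
  have hpos : 0 < v ⬝ᵥ v := by simpa using dotProduct_star_self_pos_iff.2 hv0
  have h1 := hpd.dotProduct_mulVec_pos hv0
  have h2 := hpsd.dotProduct_mulVec_nonneg v
  simp only [star_trivial, add_mulVec, sub_mulVec, one_mulVec, hv, dotProduct_add,
    dotProduct_sub, dotProduct_smul, smul_eq_mul] at h1 h2
  constructor <;> nlinarith

/-- The powers of a symmetric matrix with spectrum in `(-1, 1]` converge strongly. -/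
lemma Matrix.IsHermitian.exists_tendsto_pow_mulVec {ι : Type*} [Fintype ι] [DecidableEq ι]
    {P : Matrix ι ι ℝ} (hP : P.IsHermitian)
    (hev : ∀ i, hP.eigenvalues i ∈ Set.Ioc (-1) 1) (x : ι → ℝ) :
    ∃ y, Tendsto (fun k : ℕ => (P ^ k) *ᵥ x) atTop (nhds y) := by
  choose l hl using fun i => exists_tendsto_pow_of_mem_Ioc (hev i)
  let b := hP.eigenvectorBasis
  let c := b.repr (WithLp.toLp 2 x)
  have hx : x = ∑ i, c i • (b i).ofLp := by
    simpa using congrArg WithLp.ofLp (b.sum_repr (WithLp.toLp 2 x)).symm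
  refine ⟨∑ i, c i • l i • (b i).ofLp, ?_⟩
  have hk (k : ℕ) : (P ^ k) *ᵥ x = ∑ i, c i • hP.eigenvalues i ^ k • (b i).ofLp := by
    rw [hx, mulVec_sum]
    simp only [mulVec_smul, pow_mulVec_of_mulVec_eq_smul (hP.mulVec_eigenvectorBasis _) k, b]
  simp only [hk]
  exact tendsto_finsetSum _ fun i _ => ((hl i).smul_const _).const_smul _

/-- Let `P` be a real symmetric `n×n` matrix with all eigenvalues in
`(−1, 1]` (i.e. `I + P` positive definite and `I − P` positive semidefinite), and let
`x ∈ ℝⁿ` have nonzero orthogonal projection onto `ker(P − I)` (equivalently, some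
eigenvector `w` with `Pw = w` satisfies `⟨w, x⟩ ≠ 0`). Then `Pᵏx ≠ 0` for all `k`, the
cosine `cos_k = ⟨Pᵏx, P^{k+1}x⟩/(‖Pᵏx‖·‖P^{k+1}x‖)` tends to `1`, and the angle
`arccos(cos_k)` tends to `0`. -/
theorem stmt2 {n : ℕ} (P : Matrix (Fin n) (Fin n) ℝ) (hP : P.IsSymm)
    (hpd : (1 + P).PosDef) (hpsd : (1 - P).PosSemidef)
    (x : Fin n → ℝ) (hx : ∃ w : Fin n → ℝ, P *ᵥ w = w ∧ w ⬝ᵥ x ≠ 0) :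
    (∀ k : ℕ, (P ^ k) *ᵥ x ≠ 0) ∧
    Tendsto (fun k : ℕ =>
        ((P ^ k) *ᵥ x) ⬝ᵥ ((P ^ (k + 1)) *ᵥ x) /
          (Real.sqrt (((P ^ k) *ᵥ x) ⬝ᵥ ((P ^ k) *ᵥ x)) *
            Real.sqrt (((P ^ (k + 1)) *ᵥ x) ⬝ᵥ ((P ^ (k + 1)) *ᵥ x))))
      atTop (nhds 1) ∧
    Tendsto (fun k : ℕ =>
        Real.arccos (((P ^ k) *ᵥ x) ⬝ᵥ ((P ^ (k + 1)) *ᵥ x) /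
          (Real.sqrt (((P ^ k) *ᵥ x) ⬝ᵥ ((P ^ k) *ᵥ x)) *
            Real.sqrt (((P ^ (k + 1)) *ᵥ x) ⬝ᵥ ((P ^ (k + 1)) *ᵥ x)))))
      atTop (nhds 0) := by
  obtain ⟨w, hw, hwx⟩ := hx
  have hwk (k : ℕ) : w ⬝ᵥ (P ^ k) *ᵥ x = w ⬝ᵥ x := by
    have h : (P ^ k) *ᵥ w = w := by
      simpa using pow_mulVec_of_mulVec_eq_smul (A := P) (v := w) (r := 1) (by simpa using hw) k
    rw [dotProduct_mulVec, ← mulVec_transpose, (hP.pow k).eq, h]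
  have hH : P.IsHermitian := by rwa [IsHermitian, conjTranspose_eq_transpose_of_trivial]
  obtain ⟨y, hy⟩ := hH.exists_tendsto_pow_mulVec (hH.eigenvalues_mem_Ioc hpd hpsd) x
  have hy' := hy.comp (tendsto_add_atTop_nat 1)
  have hdot {u v : ℕ → Fin n → ℝ} (hu : Tendsto u atTop (nhds y))
      (hv : Tendsto v atTop (nhds y)) :
      Tendsto (fun k => u k ⬝ᵥ v k) atTop (nhds (y ⬝ᵥ y)) :=
    tendsto_finsetSum _ fun i _ => (tendsto_pi_nhds.1 hu i).mul (tendsto_pi_nhds.1 hv i)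
  have hwy : w ⬝ᵥ y = w ⬝ᵥ x := by
    refine tendsto_nhds_unique (f := fun k : ℕ => w ⬝ᵥ (P ^ k) *ᵥ x) (l := atTop) ?_ ?_
    · exact tendsto_finsetSum _ fun i _ => (tendsto_pi_nhds.1 hy i).const_mul _
    · simp only [hwk, tendsto_const_nhds]
  have hy0 : y ≠ 0 := by
    rintro rfl
    exact hwx (by simpa using hwy.symm)
  have hpos : 0 < y ⬝ᵥ y := by simpa using dotProduct_star_self_pos_iff.2 hy0
  have hcos := (hdot hy hy').div ((hdot hy hy).sqrt.mul (hdot hy' hy').sqrt)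
    (by positivity)
  rw [Real.mul_self_sqrt hpos.le, div_self hpos.ne'] at hcos
  refine ⟨fun k h => hwx ?_, hcos, ?_⟩
  · rw [← hwk k, h, dotProduct_zero]
  · rw [← Real.arccos_one]
    exact (Real.continuous_arccos.tendsto 1).comp hcos
end

section
/- Let P be a real symmetric n×n matrix with all eigenvalues in (−1, 1] (i.e., I + P is positive definite and I − P is positive semidefinite), and let x ∈ ℝⁿ be a vector whose orthogonal projection onto the eigenspace ker(P − I) is nonzero. Then there exists an integer η ∈ ℕ such that for all k ≥ η the sequence cos_k := ⟨Pᵏx, P^{k+1}x⟩ / (‖Pᵏx‖·‖P^{k+1}x‖) is monotonically nondecreasing in k; equivalently, the angle arccos(cos_k) between Pᵏx and P^{k+1}x is monotonically nonincreasing for k ≥ η. -/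
open Matrix

/-- A symmetric matrix moves across the dot product. -/
theorem dotProduct_mulVec_comm_of_isSymm {ι : Type*} [Fintype ι] {A : Matrix ι ι ℝ}
    (hA : A.IsSymm) (u v : ι → ℝ) : u ⬝ᵥ (A *ᵥ v) = (A *ᵥ u) ⬝ᵥ v := by
  rw [dotProduct_mulVec, ← mulVec_transpose, hA.eq]

theorem pow_mulVec_dotProduct_pow_mulVec {ι : Type*} [Fintype ι] [DecidableEq ι]
    {A : Matrix ι ι ℝ} (hA : A.IsSymm) (x : ι → ℝ) (k l : ℕ) :
    ((A ^ k) *ᵥ x) ⬝ᵥ ((A ^ l) *ᵥ x) = x ⬝ᵥ ((A ^ (k + l)) *ᵥ x) := by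
  rw [← dotProduct_mulVec_comm_of_isSymm (hA.pow k), mulVec_mulVec, pow_add]

/-- Power moments of a symmetric matrix `P` with spectrum in `(-1, 1]` at a vector with a nonzero
component in `ker (P - 1)`. -/
theorem exists_moments_eq_add_sum {n : ℕ} (P : Matrix (Fin n) (Fin n) ℝ) (hP : P.IsSymm)
    (hpd : (1 + P).PosDef) (hpsd : (1 - P).PosSemidef)
    (x : Fin n → ℝ) (hx : ∃ w : Fin n → ℝ, P *ᵥ w = w ∧ w ⬝ᵥ x ≠ 0) :
    ∃ (c : ℝ) (s : Finset (Fin n)) (a μ : Fin n → ℝ), 0 < c ∧ (∀ i ∈ s, 0 ≤ a i) ∧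
      (∀ i ∈ s, -1 < μ i ∧ μ i < 1) ∧
      ∀ m : ℕ, x ⬝ᵥ ((P ^ m) *ᵥ x) = c + ∑ i ∈ s, a i * μ i ^ m := by
  classical
  have hH : P.IsHermitian := by
    rw [IsHermitian, conjTranspose_eq_transpose_of_trivial, hP.eq]
  set μ := hH.eigenvalues with hμ
  set v : Fin n → Fin n → ℝ := fun i => (hH.eigenvectorBasis i).ofLp with hv
  have hPv (i : Fin n) : P *ᵥ v i = μ i • v i := hH.mulVec_eigenvectorBasis i
  have hparseval (y z : Fin n → ℝ) : y ⬝ᵥ z = ∑ i, (v i ⬝ᵥ y) * (v i ⬝ᵥ z) := by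
    have h := hH.eigenvectorBasis.sum_inner_mul_inner (WithLp.toLp 2 y) (WithLp.toLp 2 z)
    simp only [EuclideanSpace.inner_eq_star_dotProduct, star_trivial] at h
    rw [dotProduct_comm y z, ← h]
    exact Finset.sum_congr rfl fun i _ => by rw [dotProduct_comm z]
  have hvv (i : Fin n) : v i ⬝ᵥ v i = 1 := by
    have h := hH.eigenvectorBasis.inner_eq_one i
    simpa only [EuclideanSpace.inner_eq_star_dotProduct, star_trivial] using h
  have hv0 (i : Fin n) : v i ≠ 0 := fun h => by simpa [h] using hvv i
  have hlow (i : Fin n) : -1 < μ i := by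
    have h := hpd.dotProduct_mulVec_pos (hv0 i)
    simp only [star_trivial, add_mulVec, one_mulVec, hPv, dotProduct_add, dotProduct_smul, hvv,
      smul_eq_mul] at h
    linarith
  have hup (i : Fin n) : μ i ≤ 1 := by
    have h := hpsd.dotProduct_mulVec_nonneg (v i)
    simp only [star_trivial, sub_mulVec, one_mulVec, hPv, dotProduct_sub, dotProduct_smul, hvv,
      smul_eq_mul] at h
    linarith
  have hpow (i : Fin n) (m : ℕ) : v i ⬝ᵥ ((P ^ m) *ᵥ x) = μ i ^ m * (v i ⬝ᵥ x) := by
    induction m with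
    | zero => simp
    | succ m ih =>
      rw [pow_succ', ← mulVec_mulVec, dotProduct_mulVec_comm_of_isSymm hP, hPv, smul_dotProduct,
        ih, smul_eq_mul, pow_succ']
      ring
  refine ⟨∑ i with μ i = 1, (v i ⬝ᵥ x) ^ 2, ({i | μ i ≠ 1} : Finset (Fin n)),
    fun i => (v i ⬝ᵥ x) ^ 2, μ, ?_, fun i _ => sq_nonneg _, fun i hi => ⟨hlow i,
      lt_of_le_of_ne (hup i) (by simpa using hi)⟩, fun m => ?_⟩
  · obtain ⟨w, hw, hwx⟩ := hx
    rw [hparseval] at hwx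
    obtain ⟨i, -, hi⟩ := Finset.exists_ne_zero_of_sum_ne_zero hwx
    have hμi : μ i = 1 := by
      have h := dotProduct_mulVec_comm_of_isSymm hP (v i) w
      rw [hw, hPv, smul_dotProduct, smul_eq_mul] at h
      exact mul_right_cancel₀ (left_ne_zero_of_mul hi) (by rw [← h, one_mul])
    exact Finset.sum_pos' (fun i _ => sq_nonneg _)
      ⟨i, by simpa using hμi, by have := right_ne_zero_of_mul hi; positivity⟩
  · rw [hparseval, ← Finset.sum_filter_add_sum_filter_not Finset.univ (fun i => μ i = 1)]
    congr 1
    · refine Finset.sum_congr rfl fun i hi => ?_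
      rw [hpow, (Finset.mem_filter.mp hi).2]
      ring
    · refine Finset.sum_congr rfl fun i _ => ?_
      rw [hpow]
      ring

/-- The perturbation `c + b j` of a positive constant satisfies the cosine inequality as soon as
the first-order part dominates and `b` is small. -/
theorem sq_mul_le_sq_mul_of_small_perturbation {c δ b₀ b₁ b₃ b₄ : ℝ} (hc : 0 < c) (h₀ : 0 ≤ b₀)
    (h₁ : |b₁| ≤ b₀) (h₃ : |b₃| ≤ b₀) (h₄ : |b₄| ≤ b₀)
    (hlin : δ * b₀ ≤ b₀ - 2 * b₁ + 2 * b₃ - b₄) (hbc : b₀ < c) (hbδ : 6 * b₀ ≤ c * δ) :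
    (c + b₁) ^ 2 * (c + b₄) ≤ (c + b₃) ^ 2 * (c + b₀) := by
  have e₁ : b₁ ^ 2 ≤ b₀ ^ 2 := sq_le_sq' (abs_le.mp h₁).1 (abs_le.mp h₁).2
  have e₁₄ : b₁ * b₄ ≤ b₀ ^ 2 := by
    rw [sq]
    exact (le_abs_self _).trans (by rw [abs_mul]; gcongr)
  have e₃₀ : -(b₀ ^ 2) ≤ b₃ * b₀ := by nlinarith [(abs_le.mp h₃).1]
  have e₁₁₄ : b₁ ^ 2 * b₄ ≤ b₀ ^ 2 * c :=
    calc b₁ ^ 2 * b₄ ≤ b₁ ^ 2 * b₀ := by gcongr; exact (abs_le.mp h₄).2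
      _ ≤ b₀ ^ 2 * c := by gcongr
  have hquad : c * (-(5 * b₀ ^ 2)) ≤ c * (b₃ ^ 2 + 2 * (b₃ * b₀) - b₁ ^ 2 - 2 * (b₁ * b₄)) := by
    gcongr
    nlinarith [sq_nonneg b₃]
  have hlin' : c ^ 2 * (δ * b₀) ≤ c ^ 2 * (b₀ - 2 * b₁ + 2 * b₃ - b₄) := by gcongr
  have hdom : 6 * b₀ * (c * b₀) ≤ c * δ * (c * b₀) := by gcongr
  have h₃₃₀ : 0 ≤ b₃ ^ 2 * b₀ := by positivity
  nlinarith

theorem div_sqrt_mul_sqrt_le_of_sq_mul_le {p₀ p₁ p₂ p₃ p₄ : ℝ} (h₀ : 0 < p₀) (h₂ : 0 < p₂)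
    (h₃ : 0 < p₃) (h₄ : 0 < p₄) (h : p₁ ^ 2 * p₄ ≤ p₃ ^ 2 * p₀) :
    p₁ / (√p₀ * √p₂) ≤ p₃ / (√p₂ * √p₄) := by
  have key : p₁ * √p₄ ≤ p₃ * √p₀ := by
    refine le_of_abs_le (abs_le_of_sq_le_sq ?_ (by positivity))
    rwa [mul_pow, mul_pow, Real.sq_sqrt h₄.le, Real.sq_sqrt h₀.le]
  have hs : 0 < √p₂ := Real.sqrt_pos.mpr h₂
  rw [div_le_div_iff₀ (by positivity) (by positivity)]
  nlinarith

/-- The moments `c + ∑ aᵢ μᵢ ^ m` with `|μᵢ| < 1` eventually have nondecreasing cosines. -/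
theorem exists_forall_ge_cosine_le {ι : Type*} (s : Finset ι) {c : ℝ} {a μ : ι → ℝ} (hc : 0 < c)
    (ha : ∀ i ∈ s, 0 ≤ a i) (hμ : ∀ i ∈ s, -1 < μ i ∧ μ i < 1) {p : ℕ → ℝ}
    (hp : ∀ m, p m = c + ∑ i ∈ s, a i * μ i ^ m) :
    ∃ η : ℕ, ∀ k, η ≤ k → p (2 * k + 1) / (√(p (2 * k)) * √(p (2 * k + 2))) ≤
      p (2 * k + 3) / (√(p (2 * k + 2)) * √(p (2 * k + 4))) := by
  set b : ℕ → ℝ := fun m => ∑ i ∈ s, a i * μ i ^ m with hb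
  have hgap : ∃ δ : ℝ, 0 < δ ∧ ∀ i ∈ s, δ ≤ (1 - μ i) ^ 3 * (1 + μ i) := by
    have hpos : ∀ i ∈ s, 0 < (1 - μ i) ^ 3 * (1 + μ i) := fun i hi =>
      mul_pos (pow_pos (by linarith [(hμ i hi).2]) 3) (by linarith [(hμ i hi).1])
    rcases s.eq_empty_or_nonempty with rfl | hs
    · exact ⟨1, one_pos, by simp⟩
    · obtain ⟨j, hj, hmin⟩ := s.exists_min_image (fun i => (1 - μ i) ^ 3 * (1 + μ i)) hs
      exact ⟨_, hpos j hj, hmin⟩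
  obtain ⟨δ, hδ, hgap⟩ := hgap
  have hlim : Filter.Tendsto (fun k => b (2 * k)) Filter.atTop (nhds 0) := by
    have h : Filter.Tendsto b Filter.atTop (nhds (∑ i ∈ s, a i * 0)) :=
      tendsto_finsetSum s fun i hi =>
        (tendsto_pow_atTop_nhds_zero_of_abs_lt_one (abs_lt.mpr (hμ i hi))).const_mul (a i)
    simp only [mul_zero, Finset.sum_const_zero] at h
    exact h.comp (Filter.tendsto_id.const_mul_atTop' two_pos)
  have hev : ∀ᶠ k in Filter.atTop, b (2 * k) < min c (c * δ / 6) :=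
    hlim.eventually_lt_const (lt_min hc (by positivity))
  obtain ⟨η, hη⟩ := Filter.eventually_atTop.mp hev
  refine ⟨η, fun k hk => ?_⟩
  obtain ⟨hbc, hbδ⟩ := lt_min_iff.mp (hη k hk)
  have heven (i : ι) : 0 ≤ μ i ^ (2 * k) := (even_two_mul k).pow_nonneg _
  have h₀ : 0 ≤ b (2 * k) := Finset.sum_nonneg fun i hi => mul_nonneg (ha i hi) (heven i)
  have habs (j : ℕ) : |b (2 * k + j)| ≤ b (2 * k) := by
    refine (Finset.abs_sum_le_sum_abs _ _).trans (Finset.sum_le_sum fun i hi => ?_)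
    rw [abs_mul, abs_of_nonneg (ha i hi), pow_add, abs_mul, abs_of_nonneg (heven i), abs_pow]
    exact mul_le_mul_of_nonneg_left (mul_le_of_le_one_right (heven i)
      (pow_le_one₀ (abs_nonneg _) (abs_lt.mpr (hμ i hi)).le)) (ha i hi)
  have hlin : δ * b (2 * k) ≤
      b (2 * k) - 2 * b (2 * k + 1) + 2 * b (2 * k + 3) - b (2 * k + 4) := by
    simp only [hb, Finset.mul_sum]
    rw [← Finset.sum_sub_distrib, ← Finset.sum_add_distrib, ← Finset.sum_sub_distrib]
    refine Finset.sum_le_sum fun i hi => ?_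
    calc δ * (a i * μ i ^ (2 * k))
        ≤ (1 - μ i) ^ 3 * (1 + μ i) * (a i * μ i ^ (2 * k)) :=
          mul_le_mul_of_nonneg_right (hgap i hi) (mul_nonneg (ha i hi) (heven i))
      _ = _ := by ring
  have hpos (j : ℕ) : 0 < p (2 * k + j) := by
    rw [hp]
    linarith [(abs_le.mp (habs j)).1]
  refine div_sqrt_mul_sqrt_le_of_sq_mul_le (hpos 0) (hpos 2) (hpos 3) (hpos 4) ?_
  simp only [hp]
  exact sq_mul_le_sq_mul_of_small_perturbation hc h₀ (habs 1) (habs 3) (habs 4) hlin hbc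
    (by linarith)

/-- Let `P` be a real symmetric `n×n` matrix with all eigenvalues in
`(−1, 1]` (i.e. `I + P` positive definite and `I − P` positive semidefinite), and let
`x ∈ ℝⁿ` have nonzero orthogonal projection onto `ker(P − I)`. Then there exists
`η ∈ ℕ` such that for all `k ≥ η` the cosine
`cos_k = ⟨Pᵏx, P^{k+1}x⟩/(‖Pᵏx‖·‖P^{k+1}x‖)` is nondecreasing in `k`; equivalently the
angle `arccos(cos_k)` is nonincreasing for `k ≥ η`. -/
theorem stmt3 {n : ℕ} (P : Matrix (Fin n) (Fin n) ℝ) (hP : P.IsSymm)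
    (hpd : (1 + P).PosDef) (hpsd : (1 - P).PosSemidef)
    (x : Fin n → ℝ) (hx : ∃ w : Fin n → ℝ, P *ᵥ w = w ∧ w ⬝ᵥ x ≠ 0) :
    ∃ η : ℕ, ∀ k : ℕ, η ≤ k →
      (((P ^ k) *ᵥ x) ⬝ᵥ ((P ^ (k + 1)) *ᵥ x) /
          (Real.sqrt (((P ^ k) *ᵥ x) ⬝ᵥ ((P ^ k) *ᵥ x)) *
            Real.sqrt (((P ^ (k + 1)) *ᵥ x) ⬝ᵥ ((P ^ (k + 1)) *ᵥ x))) ≤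
        ((P ^ (k + 1)) *ᵥ x) ⬝ᵥ ((P ^ (k + 2)) *ᵥ x) /
          (Real.sqrt (((P ^ (k + 1)) *ᵥ x) ⬝ᵥ ((P ^ (k + 1)) *ᵥ x)) *
            Real.sqrt (((P ^ (k + 2)) *ᵥ x) ⬝ᵥ ((P ^ (k + 2)) *ᵥ x)))) ∧
      (Real.arccos (((P ^ (k + 1)) *ᵥ x) ⬝ᵥ ((P ^ (k + 2)) *ᵥ x) /
          (Real.sqrt (((P ^ (k + 1)) *ᵥ x) ⬝ᵥ ((P ^ (k + 1)) *ᵥ x)) *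
            Real.sqrt (((P ^ (k + 2)) *ᵥ x) ⬝ᵥ ((P ^ (k + 2)) *ᵥ x)))) ≤
        Real.arccos (((P ^ k) *ᵥ x) ⬝ᵥ ((P ^ (k + 1)) *ᵥ x) /
          (Real.sqrt (((P ^ k) *ᵥ x) ⬝ᵥ ((P ^ k) *ᵥ x)) *
            Real.sqrt (((P ^ (k + 1)) *ᵥ x) ⬝ᵥ ((P ^ (k + 1)) *ᵥ x))))) := by
  obtain ⟨c, s, a, μ, hc, ha, hμ, hp⟩ := exists_moments_eq_add_sum P hP hpd hpsd x hx
  obtain ⟨η, hη⟩ := exists_forall_ge_cosine_le s hc ha hμ hp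
  refine ⟨η, fun k hk => ?_⟩
  have h := hη k hk
  simp only [pow_mulVec_dotProduct_pow_mulVec hP]
  rw [show k + (k + 1) = 2 * k + 1 by ring, show k + k = 2 * k by ring,
    show k + 1 + (k + 1) = 2 * k + 2 by ring, show k + 1 + (k + 2) = 2 * k + 3 by ring,
    show k + 2 + (k + 2) = 2 * k + 4 by ring]
  exact ⟨h, Real.arccos_le_arccos h⟩
end
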